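/- arXiv:1502.02166 — 5 statements merged into one kernel-verified Lean document; each statement's English description precedes it below -/
import Mathlib

section
/- Let α, β > 2 be real numbers. Set T = (α+β)·√((α+β+1)/(αβ)), a = −√(α(α+β+1)/β) and b = √(β(α+β+1)/α). Define the beta wavelet ψ_{α,β} : ℝ → ℝ by ψ_{α,β}(t) = −(1/(B(α,β)·T^{α+β−1}))·[(α−1)·(t−a)^{α−2}·(b−t)^{β−1} − (β−1)·(t−a)^{α−1}·(b−t)^{β−2}] for a < t < b, and ψ_{α,β}(t) = 0 for t ≤ a or t ≥ b. Then ψ_{α,β} is continuous on all of ℝ (in particular ψ_{α,β}(t) → 0 as t → a⁺ and as t → b⁻). -/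
/-- The Euler Beta function `B(x,y) = Γ(x)Γ(y)/Γ(x+y)`. -/
noncomputable def betaFn (x y : ℝ) : ℝ := Real.Gamma x * Real.Gamma y / Real.Gamma (x + y)

/-- Proposition 1: beta one-cycle wavelets with parameters `α > 2`, `β > 2` are
continuous wavelets of compact support. -/
theorem beta_wavelet_continuous (α β : ℝ) (hα : 2 < α) (hβ : 2 < β)
    (T a b : ℝ)
    (hT : T = (α + β) * Real.sqrt ((α + β + 1) / (α * β)))
    (ha : a = -Real.sqrt (α * (α + β + 1) / β))
    (hb : b = Real.sqrt (β * (α + β + 1) / α))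
    (ψ : ℝ → ℝ)
    (hmid : ∀ t : ℝ, a < t → t < b →
      ψ t = -(1 / (betaFn α β * T ^ (α + β - 1))) *
        ((α - 1) * (t - a) ^ (α - 2) * (b - t) ^ (β - 1)
          - (β - 1) * (t - a) ^ (α - 1) * (b - t) ^ (β - 2)))
    (hout : ∀ t : ℝ, t ≤ a ∨ b ≤ t → ψ t = 0) :
    Continuous ψ := by
  have key : ψ = fun t => -(1 / (betaFn α β * T ^ (α + β - 1))) *
      ((α - 1) * max (t - a) 0 ^ (α - 2) * max (b - t) 0 ^ (β - 1)
        - (β - 1) * max (t - a) 0 ^ (α - 1) * max (b - t) 0 ^ (β - 2)) := by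
    have hα₁ : α - 1 ≠ 0 := by linarith
    have hα₂ : α - 2 ≠ 0 := by linarith
    have hβ₁ : β - 1 ≠ 0 := by linarith
    have hβ₂ : β - 2 ≠ 0 := by linarith
    funext t
    rcases le_or_gt t a with h | h
    · rw [hout t (Or.inl h), max_eq_right (sub_nonpos.2 h), Real.zero_rpow hα₁,
        Real.zero_rpow hα₂]
      ring
    rcases le_or_gt b t with h' | h'
    · rw [hout t (Or.inr h'), max_eq_right (sub_nonpos.2 h'), Real.zero_rpow hβ₁,
        Real.zero_rpow hβ₂]
      ring
    rw [hmid t h h', max_eq_left (sub_pos.2 h).le, max_eq_left (sub_pos.2 h').le]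
  have hl : ∀ p : ℝ, 0 ≤ p → Continuous fun t : ℝ => max (t - a) 0 ^ p := fun p hp =>
    (Real.continuous_rpow_const hp).comp (by fun_prop)
  have hr : ∀ p : ℝ, 0 ≤ p → Continuous fun t : ℝ => max (b - t) 0 ^ p := fun p hp =>
    (Real.continuous_rpow_const hp).comp (by fun_prop)
  rw [key]
  exact continuous_const.mul
    (((continuous_const.mul (hl _ (by linarith))).mul (hr _ (by linarith))).sub
      ((continuous_const.mul (hl _ (by linarith))).mul (hr _ (by linarith))))
end

section
/- Let α, β > 1 be real numbers. Set T = (α+β)·√((α+β+1)/(αβ)), a = −√(α(α+β+1)/β), b = √(β(α+β+1)/α), φ_{α,β}(t) = (1/(B(α,β)·T^{α+β−1}))·(t−a)^{α−1}·(b−t)^{β−1} on (a,b), and ψ_{α,β}(t) = −φ'_{α,β}(t) on (a,b). Let t₀ = ((α−β)/(α+β−2))·√((α+β+1)/(αβ)) (assume (α,β) ≠ (1,1) so the denominator is nonzero). Then t₀ ∈ (a,b), ψ_{α,β}(t₀) = 0, ψ_{α,β}(t) < 0 for all t ∈ (a, t₀), and ψ_{α,β}(t) > 0 for all t ∈ (t₀,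 b). In particular t₀ is the unique zero of ψ_{α,β} in (a,b), and ψ_{α,β} consists of exactly one negative half-cycle followed by one positive half-cycle. -/
theorem betaFn_pos {x y : ℝ} (hx : 0 < x) (hy : 0 < y) : 0 < betaFn x y :=
  div_pos (mul_pos (Real.Gamma_pos_of_pos hx) (Real.Gamma_pos_of_pos hy))
    (Real.Gamma_pos_of_pos (add_pos hx hy))

/-- The derivative of a beta-type density `c (t - a)^p (b - t)^q` inside `(a, b)`. -/
theorem hasDerivAt_const_mul_sub_rpow_mul_sub_rpow (c p q : ℝ) {a b t : ℝ}
    (hat : a < t) (htb : t < b) :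
    HasDerivAt (fun t => c * (t - a) ^ p * (b - t) ^ q)
      (c * (t - a) ^ (p - 1) * (b - t) ^ (q - 1) * (p * (b - t) - q * (t - a))) t := by
  have hl : 0 < t - a := sub_pos.2 hat
  have hr : 0 < b - t := sub_pos.2 htb
  have h₁ := ((hasDerivAt_id' t).sub_const a).rpow_const (p := p) (Or.inl hl.ne')
  have h₂ := ((hasDerivAt_id' t).const_sub b).rpow_const (p := q) (Or.inl hr.ne')
  refine ((h₁.const_mul c).mul h₂).congr_deriv ?_
  have e₁ : (t - a) ^ p = (t - a) ^ (p - 1) * (t - a) := by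
    rw [← Real.rpow_add_one hl.ne', sub_add_cancel]
  have e₂ : (b - t) ^ q = (b - t) ^ (q - 1) * (b - t) := by
    rw [← Real.rpow_add_one hr.ne', sub_add_cancel]
  rw [e₁, e₂]
  ring

/-- Scaling `√(k / (x * y))` by `x` gives `√(x * k / y)`. -/
theorem sqrt_mul_div_eq_mul_sqrt {x y : ℝ} (k : ℝ) (hx : 0 < x) :
    Real.sqrt (x * k / y) = x * Real.sqrt (k / (x * y)) := by
  rw [← Real.sqrt_sq hx.le, ← Real.sqrt_mul (sq_nonneg x), Real.sqrt_sq hx.le]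
  congr 1
  field_simp

/-- The beta wavelet `ψ = -φ'` has a unique zero crossing in `(a,b)` at
`t₀ = ((α-β)/(α+β-2))·√((α+β+1)/(αβ))`: it is negative before `t₀` and positive
after, i.e. it consists of exactly one negative and one positive half-cycle. -/
theorem beta_wavelet_zero_crossing (α β : ℝ) (hα : 1 < α) (hβ : 1 < β)
    (hne : (α, β) ≠ (1, 1))
    (T a b : ℝ)
    (hT : T = (α + β) * Real.sqrt ((α + β + 1) / (α * β)))
    (ha : a = -Real.sqrt (α * (α + β + 1) / β))
    (hb : b = Real.sqrt (β * (α + β + 1) / α))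
    (φ ψ : ℝ → ℝ)
    (hφ : ∀ t : ℝ, φ t = (1 / (betaFn α β * T ^ (α + β - 1))) *
      (t - a) ^ (α - 1) * (b - t) ^ (β - 1))
    (hψ : ∀ t : ℝ, a < t → t < b → ψ t = -deriv φ t)
    (t₀ : ℝ)
    (ht₀ : t₀ = ((α - β) / (α + β - 2)) * Real.sqrt ((α + β + 1) / (α * β))) :
    t₀ ∈ Set.Ioo a b
    ∧ ψ t₀ = 0
    ∧ (∀ t : ℝ, a < t → t < t₀ → ψ t < 0)
    ∧ (∀ t : ℝ, t₀ < t → t < b → 0 < ψ t) := by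
  have hα₀ : 0 < α := by linarith
  have hβ₀ : 0 < β := by linarith
  have hd : 0 < α + β - 2 := by linarith
  set s := Real.sqrt ((α + β + 1) / (α * β)) with hs
  have hs₀ : 0 < s := Real.sqrt_pos.2 (by positivity)
  replace ha : a = -(α * s) := by rw [ha, hs, sqrt_mul_div_eq_mul_sqrt _ hα₀]
  replace hb : b = β * s := by
    rw [hb, hs, sqrt_mul_div_eq_mul_sqrt _ hβ₀, mul_comm β α]
  have hT₀ : 0 < T := by rw [hT]; positivity
  have hroot : (α + β - 2) * t₀ = (α - β) * s := by
    rw [ht₀]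
    field_simp
  have hat₀ : a < t₀ := by
    refine lt_of_mul_lt_mul_left ?_ hd.le
    rw [hroot, ha]
    nlinarith [mul_pos hs₀ (mul_pos (sub_pos.2 hα) (add_pos hα₀ hβ₀))]
  have ht₀b : t₀ < b := by
    refine lt_of_mul_lt_mul_left ?_ hd.le
    rw [hroot, hb]
    nlinarith [mul_pos hs₀ (mul_pos (sub_pos.2 hβ) (add_pos hα₀ hβ₀))]
  have hfactor : ∀ t, a < t → t < b → ∃ K, 0 < K ∧ ψ t = K * (t - t₀) := by
    intro t hat htb
    have hl : 0 < t - a := sub_pos.2 hat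
    have hr : 0 < b - t := sub_pos.2 htb
    have hB := betaFn_pos hα₀ hβ₀
    refine ⟨1 / (betaFn α β * T ^ (α + β - 1)) * (t - a) ^ (α - 1 - 1) *
      (b - t) ^ (β - 1 - 1) * (α + β - 2), by positivity, ?_⟩
    rw [hψ t hat htb, funext hφ,
      (hasDerivAt_const_mul_sub_rpow_mul_sub_rpow _ _ _ hat htb).deriv]
    have hlin : (α - 1) * (b - t) - (β - 1) * (t - a) = -((α + β - 2) * (t - t₀)) := by
      rw [ha, hb]
      linear_combination -hroot
    rw [hlin]
    ring
  refine ⟨⟨hat₀, ht₀b⟩, ?_, fun t hat ht => ?_, fun t ht htb => ?_⟩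
  · obtain ⟨K, -, hK⟩ := hfactor t₀ hat₀ ht₀b
    rw [hK, sub_self, mul_zero]
  · obtain ⟨K, hK₀, hK⟩ := hfactor t hat (ht.trans ht₀b)
    rw [hK]
    exact mul_neg_of_pos_of_neg hK₀ (sub_neg.2 ht)
  · obtain ⟨K, hK₀, hK⟩ := hfactor t (hat₀.trans ht) htb
    rw [hK]
    exact mul_pos hK₀ (sub_pos.2 ht)
end

section
/- Let α, β > 2 be real numbers. Set T = (α+β)·√((α+β+1)/(αβ)), a = −√(α(α+β+1)/β), b = √(β(α+β+1)/α), and let ψ_{α,β}(t) = −φ'_{α,β}(t) on (a,b) and 0 outside, where φ_{α,β}(t) = (1/(B(α,β)·T^{α+β−1}))·(t−a)^{α−1}·(b−t)^{β−1}. Then for every ω ∈ ℝ, the spectrum Ψ_{α,β}(ω) = ∫_ℝ e^{−iωt}·ψ_{α,β}(t) dt satisfies Ψ_{α,β}(ω) = −iω · e^{iω·√(α(α+β+1)/β)} · (Γ(α+β)/(Γ(α)·Γ(β))) · ∫_0^1 e^{−iωTu}·u^{α−1}·(1−u)^{β−1} du. -/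
/-- Integration by parts for the Fourier integral of the derivative of a function which vanishes
at both endpoints. -/
lemma fourierIntegral_neg_deriv_of_eq_zero {a b ω : ℝ} {f f' : ℝ → ℝ}
    (hf : ∀ t, HasDerivAt f (f' t) t) (hf' : Continuous f') (h_left : f a = 0)
    (h_right : f b = 0) :
    ∫ t in a..b, Complex.exp (-(Complex.I * ω * t)) * ((-f' t : ℝ) : ℂ)
      = -Complex.I * ω * ∫ t in a..b, Complex.exp (-(Complex.I * ω * t)) * (f t : ℂ) := by
  have hexp (t : ℝ) : HasDerivAt (fun t : ℝ => Complex.exp (-(Complex.I * ω * t)))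
      (-Complex.I * ω * Complex.exp (-(Complex.I * ω * t))) t := by
    have h : HasDerivAt (fun t : ℝ => -(Complex.I * ω * t)) (-(Complex.I * ω * 1)) t :=
      ((hasDerivAt_id t).ofReal_comp.const_mul (Complex.I * ω)).neg
    convert h.cexp using 1
    ring
  have hparts := intervalIntegral.integral_mul_deriv_eq_deriv_mul (a := a) (b := b)
    (fun t _ => hexp t) (fun t _ => (hf t).ofReal_comp)
    (Continuous.intervalIntegrable (by fun_prop) _ _)
    (Continuous.intervalIntegrable (by fun_prop) _ _)
  simp only [h_left, h_right, Complex.ofReal_zero, mul_zero, sub_zero, zero_sub] at hparts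
  simp only [Complex.ofReal_neg, mul_neg, intervalIntegral.integral_neg, hparts, neg_neg]
  rw [← intervalIntegral.integral_const_mul]
  simp only [mul_assoc]

/-- The derivative of `t ↦ K (t - a) ^ p (b - t) ^ q` for exponents at least one. -/
lemma hasDerivAt_const_mul_sub_rpow_mul_rpow_sub (K a b : ℝ) {p q : ℝ} (hp : 1 ≤ p) (hq : 1 ≤ q)
    (t : ℝ) :
    HasDerivAt (fun t => K * (t - a) ^ p * (b - t) ^ q)
      (K * (p * (t - a) ^ (p - 1)) * (b - t) ^ q
        + K * (t - a) ^ p * -(q * (b - t) ^ (q - 1))) t := by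
  have hleft := ((hasDerivAt_id t).sub_const a).rpow_const (p := p) (Or.inr hp)
  have hright := ((hasDerivAt_id t).const_sub b).rpow_const (p := q) (Or.inr hq)
  refine ((hleft.const_mul K).mul hright).congr_deriv ?_
  simp only [id]
  ring

lemma sqrt_mul_div_eq_mul_sqrt_div_mul {x y s : ℝ} (hx : 0 < x) (hy : 0 < y) :
    Real.sqrt (x * s / y) = x * Real.sqrt (s / (x * y)) := by
  rw [show x * s / y = x ^ 2 * (s / (x * y)) by field_simp, Real.sqrt_mul (sq_nonneg x),
    Real.sqrt_sq hx.le]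

/-- The affine substitution `t = a + T u` in the Fourier integral of a beta kernel. -/
lemma fourierIntegral_beta_kernel_eq {a b T α β ω : ℝ} (hT : 0 < T) (hab : b = a + T) (K : ℝ) :
    ∫ t in a..b, Complex.exp (-(Complex.I * ω * t)) *
        ((K * (t - a) ^ (α - 1) * (b - t) ^ (β - 1) : ℝ) : ℂ)
      = Complex.exp (-(Complex.I * ω * a)) * ((K * T ^ (α + β - 1) : ℝ) : ℂ) *
        ∫ u in (0:ℝ)..1, Complex.exp (-(Complex.I * ω * T * u)) *
          ((u ^ (α - 1) * (1 - u) ^ (β - 1) : ℝ) : ℂ) := by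
  have hsubst := intervalIntegral.smul_integral_comp_mul_add (a := 0) (b := 1)
    (fun t : ℝ => Complex.exp (-(Complex.I * ω * t)) *
      ((K * (t - a) ^ (α - 1) * (b - t) ^ (β - 1) : ℝ) : ℂ)) T a
  rw [mul_zero, zero_add, mul_one, add_comm T a, ← hab] at hsubst
  rw [← hsubst, ← intervalIntegral.integral_smul, ← intervalIntegral.integral_const_mul]
  refine intervalIntegral.integral_congr fun u hu => ?_
  rw [Set.uIcc_of_le zero_le_one] at hu
  have hpow : T ^ (α + β - 1) = T * T ^ (α - 1) * T ^ (β - 1) := by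
    nth_rewrite 2 [← Real.rpow_one T]
    rw [← Real.rpow_add hT, ← Real.rpow_add hT]
    ring_nf
  have hexp : Complex.exp (-(Complex.I * ω * ((T * u + a : ℝ) : ℂ)))
      = Complex.exp (-(Complex.I * ω * a)) * Complex.exp (-(Complex.I * ω * T * u)) := by
    rw [← Complex.exp_add]
    push_cast
    ring_nf
  simp only [hexp]
  rw [add_sub_cancel_right, show b - (T * u + a) = T * (1 - u) by rw [hab]; ring,
    Real.mul_rpow hT.le hu.1, Real.mul_rpow hT.le (sub_nonneg.2 hu.2), hpow, Complex.real_smul]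
  push_cast
  ring


/-- The spectral formula for the beta wavelet:
`Ψ(ω) = -iω · e^{iω√(α(α+β+1)/β)} · M(α, α+β, -iωT)` where the Kummer function is
written as `(Γ(α+β)/(Γ(α)Γ(β)))·∫_0^1 e^{-iωTu} u^(α-1) (1-u)^(β-1) du`. -/
theorem beta_wavelet_spectrum_formula (α β : ℝ) (hα : 2 < α) (hβ : 2 < β)
    (T a b : ℝ)
    (hT : T = (α + β) * Real.sqrt ((α + β + 1) / (α * β)))
    (ha : a = -Real.sqrt (α * (α + β + 1) / β))
    (hb : b = Real.sqrt (β * (α + β + 1) / α))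
    (φ ψ : ℝ → ℝ)
    (hφ : ∀ t : ℝ, φ t = (1 / (betaFn α β * T ^ (α + β - 1))) *
      (t - a) ^ (α - 1) * (b - t) ^ (β - 1))
    (hmid : ∀ t : ℝ, a < t → t < b → ψ t = -deriv φ t)
    (hout : ∀ t : ℝ, t ≤ a ∨ b ≤ t → ψ t = 0) :
    ∀ ω : ℝ,
      (∫ t : ℝ, Complex.exp (-(Complex.I * ω * t)) * (ψ t : ℂ))
        = -Complex.I * ω *
            Complex.exp (Complex.I * ω * (Real.sqrt (α * (α + β + 1) / β) : ℝ)) *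
            ((Real.Gamma (α + β) / (Real.Gamma α * Real.Gamma β) : ℝ) : ℂ) *
            ∫ u in (0:ℝ)..1,
              Complex.exp (-(Complex.I * ω * T * u)) *
                ((u ^ (α - 1) * (1 - u) ^ (β - 1) : ℝ) : ℂ) := by
  intro ω
  have hα0 : 0 < α := by linarith
  have hβ0 : 0 < β := by linarith
  have ha' : a = -(α * Real.sqrt ((α + β + 1) / (α * β))) := by
    rw [ha, sqrt_mul_div_eq_mul_sqrt_div_mul hα0 hβ0]
  have hb' : b = β * Real.sqrt ((α + β + 1) / (α * β)) := by
    rw [hb, sqrt_mul_div_eq_mul_sqrt_div_mul hβ0 hα0, mul_comm β α]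
  have hTpos : 0 < T := by rw [hT]; positivity
  have hab : b = a + T := by rw [ha', hb', hT]; ring
  have hle : a ≤ b := by linarith
  set K : ℝ := 1 / (betaFn α β * T ^ (α + β - 1)) with hK
  obtain rfl : φ = fun t => K * (t - a) ^ (α - 1) * (b - t) ^ (β - 1) := funext hφ
  have hderiv := hasDerivAt_const_mul_sub_rpow_mul_rpow_sub K a b (p := α - 1) (q := β - 1)
    (by linarith) (by linarith)
  have hrestrict : ∫ t : ℝ, Complex.exp (-(Complex.I * ω * t)) * (ψ t : ℂ)
      = ∫ t in a..b, Complex.exp (-(Complex.I * ω * t)) *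
        ((-(K * ((α - 1) * (t - a) ^ (α - 1 - 1)) * (b - t) ^ (β - 1)
          + K * (t - a) ^ (α - 1) * -((β - 1) * (b - t) ^ (β - 1 - 1))) : ℝ) : ℂ) := by
    rw [intervalIntegral.integral_of_le hle, MeasureTheory.integral_Ioc_eq_integral_Ioo,
      ← MeasureTheory.setIntegral_eq_integral_of_forall_compl_eq_zero (s := Set.Ioo a b)]
    · refine MeasureTheory.setIntegral_congr_fun measurableSet_Ioo fun t ht => ?_
      simp only [hmid t ht.1 ht.2, (hderiv t).deriv]
    · intro t ht
      rw [hout t, Complex.ofReal_zero, mul_zero]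
      by_contra! h
      exact ht h
  rw [hrestrict, fourierIntegral_neg_deriv_of_eq_zero hderiv ?_ ?_ ?_,
    fourierIntegral_beta_kernel_eq hTpos hab]
  · have hconst : K * T ^ (α + β - 1)
        = Real.Gamma (α + β) / (Real.Gamma α * Real.Gamma β) := by
      have := (Real.rpow_pos_of_pos hTpos (α + β - 1)).ne'
      rw [hK, betaFn]
      field_simp
    have hexp : -(Complex.I * ω * a)
        = Complex.I * ω * (Real.sqrt (α * (α + β + 1) / β) : ℝ) := by
      rw [ha]
      push_cast
      ring
    rw [hconst, hexp]
    ring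
  · have hleft {r : ℝ} (hr : 0 ≤ r) : Continuous fun t : ℝ => (t - a) ^ r :=
      (Real.continuous_rpow_const hr).comp (continuous_id.sub continuous_const)
    have hright {r : ℝ} (hr : 0 ≤ r) : Continuous fun t : ℝ => (b - t) ^ r :=
      (Real.continuous_rpow_const hr).comp (continuous_const.sub continuous_id)
    have hα1 := hleft (r := α - 1) (by linarith)
    have hα2 := hleft (r := α - 1 - 1) (by linarith)
    have hβ1 := hright (r := β - 1) (by linarith)
    have hβ2 := hright (r := β - 1 - 1) (by linarith)
    fun_prop
  · rw [sub_self, Real.zero_rpow (by linarith), mul_zero, zero_mul]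
  · rw [sub_self, Real.zero_rpow (by linarith), mul_zero]
end

section
/- Let a > 0 and b ∈ ℝ. Let f : ℝ → ℝ be integrable, and let P : ℝ → ℝ be continuously differentiable with both P and P' bounded on ℝ. Define the wavelet ψ = −P' and the blur signal f̃(a, b') = (1/√a)·∫_ℝ f(t)·P((t−b')/a) dt for b' ∈ ℝ. Then the continuous wavelet transform CWT(a,b) = (1/√a)·∫_ℝ f(t)·ψ((t−b)/a) dt satisfies CWT(a,b) = a · (∂/∂b') f̃(a, b')|_{b'=b}; that is, the wavelet transform at scale a equals a times the derivative, with respect to the shift parameter, of the low-pass (blur) version of the signal. -/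
open MeasureTheory

/-- The continuous wavelet transform at scale `a`, shift `b`, equals `a` times the
derivative, with respect to the shift, of the blur (low-pass) version
`f̃(a,b') = (1/√a)·∫ f(t)·P((t-b')/a) dt` of the signal, when the wavelet is the
blur derivative `ψ = -P'`. -/
theorem cwt_eq_blur_derivative (a b : ℝ) (ha : 0 < a)
    (f P : ℝ → ℝ)
    (hf : Integrable f)
    (hP : ContDiff ℝ 1 P)
    (hPbdd : ∃ C : ℝ, ∀ t : ℝ, |P t| ≤ C)
    (hP'bdd : ∃ C : ℝ, ∀ t : ℝ, |deriv P t| ≤ C)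
    (ψ : ℝ → ℝ) (hψ : ∀ t : ℝ, ψ t = -deriv P t) :
    HasDerivAt (fun b' : ℝ => (Real.sqrt a)⁻¹ * ∫ t : ℝ, f t * P ((t - b') / a))
      (((Real.sqrt a)⁻¹ * ∫ t : ℝ, f t * ψ ((t - b) / a)) / a) b := by
  obtain ⟨C, hC⟩ := hPbdd
  obtain ⟨D, hD⟩ := hP'bdd
  have hP' : Continuous (deriv P) := hP.continuous_deriv le_rfl
  have hψ_eq : ψ = fun t => -deriv P t := funext hψ
  have hψ_cont : Continuous ψ := hψ_eq ▸ hP'.neg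
  have hF_meas (x : ℝ) : AEStronglyMeasurable (fun t : ℝ => f t * P ((t - x) / a)) volume :=
    hf.aestronglyMeasurable.mul
      (hP.continuous.comp (by fun_prop : Continuous fun t : ℝ => (t - x) / a)).aestronglyMeasurable
  have h_diff (t x : ℝ) : HasDerivAt (fun x : ℝ => f t * P ((t - x) / a))
      (f t * (ψ ((t - x) / a) / a)) x := by
    have hlin : HasDerivAt (fun x : ℝ => (t - x) / a) (-1 / a) x :=
      ((hasDerivAt_id x).const_sub t).div_const a
    have hP_deriv := (hP.differentiable one_ne_zero ((t - x) / a)).hasDerivAt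
    refine ((hP_deriv.comp x hlin).const_mul (f t)).congr_deriv ?_
    rw [hψ]
    ring
  have key := (hasDerivAt_integral_of_dominated_loc_of_deriv_le
    (μ := volume) (x₀ := b) (s := Set.univ)
    (F := fun x t => f t * P ((t - x) / a))
    (F' := fun x t => f t * (ψ ((t - x) / a) / a))
    (bound := fun t => ‖f t‖ * (D / a)) Filter.univ_mem
    (.of_forall hF_meas)
    (hf.mul_bdd (hP.continuous.comp
      (by fun_prop : Continuous fun t : ℝ => (t - b) / a)).aestronglyMeasurable
      (.of_forall fun t => hC _))
    (hf.aestronglyMeasurable.mul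
      (by fun_prop : Continuous fun t : ℝ => ψ ((t - b) / a) / a).aestronglyMeasurable)
    (.of_forall fun t x _ => by
      rw [norm_mul, norm_div, Real.norm_of_nonneg ha.le, hψ, norm_neg]
      gcongr
      exact hD _)
    (hf.norm.mul_const (D / a))
    (.of_forall fun t x _ => h_diff t x)).2
  refine (key.const_mul (Real.sqrt a)⁻¹).congr_deriv ?_
  simp_rw [← mul_div_assoc]
  rw [integral_div, mul_div_assoc]
end

section
/- Let α, β > 1 be real numbers and let N ≥ 1 be a natural number with N < min(α,β) − 1. Set T = (α+β)·√((α+β+1)/(αβ)), a = −√(α(α+β+1)/β), b = √(β(α+β+1)/α), and φ_{α,β}(t) = (1/(B(α,β)·T^{α+β−1}))·(t−a)^{α−1}·(b−t)^{β−1} on (a,b). Define the N-th order beta wavelet ψ_N : ℝ → ℝ by ψ_N(t) = (−1)^N·(d^N φ_{α,β}/dt^N)(t) for a < t < b and ψ_N(t) = 0 for t ≤ a or t ≥ b. Then ψ_N is continuous on all of ℝ and ∫_ℝ ψ_N(t) dt = 0. -/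
open MeasureTheory Set Filter Topology

theorem hasDerivAt_max_zero_rpow {p : ℝ} (hp : 1 < p) (x : ℝ) :
    HasDerivAt (fun y : ℝ => max y 0 ^ p) (p * max x 0 ^ (p - 1)) x := by
  have hleft : ∀ y ∈ Iic (0 : ℝ), max y 0 ^ p = 0 := fun y hy => by
    rw [max_eq_right hy, Real.zero_rpow (by linarith)]
  have hright : ∀ y ∈ Ici (0 : ℝ), max y 0 ^ p = y ^ p := fun y hy => by
    rw [max_eq_left hy]
  rcases lt_trichotomy x 0 with hx | rfl | hx
  · rw [max_eq_right hx.le, Real.zero_rpow (by linarith), mul_zero]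
    exact (hasDerivAt_const x (0 : ℝ)).congr_of_eventuallyEq
      (eventually_of_mem (Iic_mem_nhds hx) hleft)
  · rw [max_self, ← hasDerivWithinAt_univ, ← Iic_union_Ici (a := (0 : ℝ))]
    refine HasDerivWithinAt.union ?_ ?_
    · rw [Real.zero_rpow (by linarith), mul_zero]
      exact (hasDerivWithinAt_const (0 : ℝ) _ (0 : ℝ)).congr hleft (hleft 0 self_mem_Iic)
    · exact (Real.hasDerivAt_rpow_const (Or.inr hp.le)).hasDerivWithinAt.congr hright
        (hright 0 self_mem_Ici)
  · rw [max_eq_left hx.le]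
    exact (Real.hasDerivAt_rpow_const (Or.inr hp.le)).congr_of_eventuallyEq
      (eventually_of_mem (Ici_mem_nhds hx) hright)

theorem contDiff_max_zero_rpow (n : ℕ) {p : ℝ} (hp : (n : ℝ) < p) :
    ContDiff ℝ n (fun y : ℝ => max y 0 ^ p) := by
  induction n generalizing p with
  | zero =>
    rw [Nat.cast_zero] at hp
    exact contDiff_zero.2 ((continuous_id.max continuous_const).rpow_const
      fun _ => Or.inr hp.le)
  | succ n ih =>
    push_cast at hp ⊢
    have hp₁ : 1 < p := by linarith [n.cast_nonneg (α := ℝ)]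
    refine contDiff_succ_iff_deriv.2 ⟨fun x => (hasDerivAt_max_zero_rpow hp₁ x).differentiableAt,
      by simp, ?_⟩
    rw [funext fun x => (hasDerivAt_max_zero_rpow hp₁ x).deriv]
    exact contDiff_const.mul (ih (by linarith))

theorem iteratedDeriv_eq_zero_of_notMem_Ioo {f : ℝ → ℝ} {a b : ℝ} {n : ℕ} (hf : ContDiff ℝ n f)
    (hzero : ∀ t ∉ Ioo a b, f t = 0) {t : ℝ} (ht : t ∉ Ioo a b) : iteratedDeriv n f t = 0 := by
  have hclosed : IsClosed {x | iteratedDeriv n f x = 0} :=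
    isClosed_eq (hf.continuous_iteratedDeriv n le_rfl) continuous_const
  have hopen : ∀ s : Set ℝ, IsOpen s → (∀ x ∈ s, x ∉ Ioo a b) →
      closure s ⊆ {x | iteratedDeriv n f x = 0} := fun s hs hsub =>
    hclosed.closure_subset_iff.2 fun x hx => by
      have h : f =ᶠ[𝓝 x] fun _ => 0 :=
        eventually_of_mem (hs.mem_nhds hx) fun y hy => hzero y (hsub y hy)
      simp [h.iteratedDeriv_eq n]
  rw [mem_Ioo, not_and_or, not_lt, not_lt] at ht
  rcases ht with ht | ht
  · exact hopen (Iio a) isOpen_Iio (fun x hx h => lt_asymm hx h.1) (by simpa using ht)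
  · exact hopen (Ioi b) isOpen_Ioi (fun x hx h => lt_asymm hx h.2) (by simpa using ht)

theorem integral_iteratedDeriv_succ_eq_zero {f : ℝ → ℝ} {n : ℕ} (hf : ContDiff ℝ (n + 1 : ℕ) f)
    {a b : ℝ} (hzero : ∀ t ∉ Ioo a b, f t = 0) : ∫ t, iteratedDeriv (n + 1) f t = 0 := by
  have hint : ∀ m ≤ n + 1, Integrable (iteratedDeriv m f) := fun m hm => by
    have hm' : ContDiff ℝ m f := hf.of_le (by exact_mod_cast hm)
    exact (hm'.continuous_iteratedDeriv m le_rfl).integrable_of_hasCompactSupport <|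
      HasCompactSupport.intro isCompact_Icc fun t ht =>
        iteratedDeriv_eq_zero_of_notMem_Ioo hm' hzero fun h => ht (Ioo_subset_Icc_self h)
  refine integral_eq_zero_of_hasDerivAt_of_integrable (f := iteratedDeriv n f) (fun t => ?_)
    (hint _ le_rfl) (hint _ n.le_succ)
  rw [iteratedDeriv_succ]
  exact (hf.differentiable_iteratedDeriv n (by exact_mod_cast n.lt_succ_self) t).hasDerivAt

/-- The `N`-th order beta wavelet `ψ_N = (-1)^N dᴺφ/dtᴺ` on `(a,b)` (and `0` outside),
for `1 ≤ N < min(α,β) - 1`, is continuous on all of `ℝ` and has zero integral. -/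
theorem high_order_beta_wavelet (α β : ℝ) (hα : 1 < α) (hβ : 1 < β)
    (N : ℕ) (hN : 1 ≤ N) (hNlt : (N : ℝ) < min α β - 1)
    (T a b : ℝ)
    (hT : T = (α + β) * Real.sqrt ((α + β + 1) / (α * β)))
    (ha : a = -Real.sqrt (α * (α + β + 1) / β))
    (hb : b = Real.sqrt (β * (α + β + 1) / α))
    (φ : ℝ → ℝ)
    (hφ : ∀ t : ℝ, φ t = (1 / (betaFn α β * T ^ (α + β - 1))) *
      (t - a) ^ (α - 1) * (b - t) ^ (β - 1))
    (ψ : ℝ → ℝ)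
    (hmid : ∀ t : ℝ, a < t → t < b → ψ t = (-1 : ℝ) ^ N * iteratedDeriv N φ t)
    (hout : ∀ t : ℝ, t ≤ a ∨ b ≤ t → ψ t = 0) :
    Continuous ψ ∧ ∫ t : ℝ, ψ t = 0 := by
  set g : ℝ → ℝ := fun t => (1 / (betaFn α β * T ^ (α + β - 1))) *
    max (t - a) 0 ^ (α - 1) * max (b - t) 0 ^ (β - 1) with hg
  have hNα : (N : ℝ) < α - 1 := hNlt.trans_le (sub_le_sub_right (min_le_left α β) 1)
  have hNβ : (N : ℝ) < β - 1 := hNlt.trans_le (sub_le_sub_right (min_le_right α β) 1)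
  have hgN : ContDiff ℝ N g :=
    (contDiff_const.mul ((contDiff_max_zero_rpow N hNα).comp (contDiff_id.sub contDiff_const))).mul
      ((contDiff_max_zero_rpow N hNβ).comp (contDiff_const.sub contDiff_id))
  have hg_zero : ∀ t ∉ Ioo a b, g t = 0 := fun t ht => by
    rw [mem_Ioo, not_and_or, not_lt, not_lt] at ht
    rcases ht with ht | ht
    · simp [hg, max_eq_right (sub_nonpos.2 ht), Real.zero_rpow (sub_pos.2 hα).ne']
    · simp [hg, max_eq_right (sub_nonpos.2 ht), Real.zero_rpow (sub_pos.2 hβ).ne']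
  have hψ : ψ = fun t => (-1 : ℝ) ^ N * iteratedDeriv N g t := by
    funext t
    by_cases ht : t ∈ Ioo a b
    · have hφg : φ =ᶠ[𝓝 t] g := eventually_of_mem (isOpen_Ioo.mem_nhds ht) fun y hy => by
        simp only [hφ, hg, max_eq_left (sub_pos.2 hy.1).le, max_eq_left (sub_pos.2 hy.2).le]
      rw [hmid t ht.1 ht.2, hφg.iteratedDeriv_eq N]
    · rw [iteratedDeriv_eq_zero_of_notMem_Ioo hgN hg_zero ht, mul_zero]
      exact hout t (by rwa [mem_Ioo, not_and_or, not_lt, not_lt] at ht)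
  obtain ⟨n, rfl⟩ := Nat.exists_eq_add_of_le' hN
  rw [hψ]
  exact ⟨continuous_const.mul (hgN.continuous_iteratedDeriv _ le_rfl), by
    rw [integral_const_mul, integral_iteratedDeriv_succ_eq_zero hgN hg_zero, mul_zero]⟩
end
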